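/- arXiv:0909.1020 — 5 statements merged into one kernel-verified Lean document; each statement's English description precedes it below -/
import Mathlib

section
/- Let ν ∈ ℝ and −ν < β₃ < β₂ < β₁. Set s² := (β₁+ν)(β₂−β₃)/((β₂+ν)(β₁−β₃)) and ρ := (β₂−β₃)/(β₂+ν). Then ∫_{β₃}^{β₂} (ξ+ν) dξ/√((ξ+ν)(β₁−ξ)(β₂−ξ)(ξ−β₃)) = 2 (β₃+ν) Λ(s,ρ)/√((β₂+ν)(β₁−β₃)), where Λ(s,ρ) := ∫₀¹ dz/((1−ρz²)√((1−z²)(1−s²z²))) is the complete elliptic integral of the third kind. Equivalently, the wave number k := 2π (∫_{β₃}^{β₂} (ξ+ν) dξ/√((ξ+ν)(β₁−ξ)(β₂−ξ)(ξ−β₃)) · 2)^{−1} · 2 equals π√((β₂+ν)(β₁−β₃))/(2(β₃+ν)Λ(s,ρ)). -/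
open Real intervalIntegral

/-- The substitution `x = a / (1 - ρ z²)` with `ρ = (b - a) / b` maps `(0, 1)` onto `(a, b)`. -/
lemma image_div_one_sub_mul_sq_Ioo {a b : ℝ} (ha : 0 < a) (hab : a < b) (ν : ℝ) :
    (fun z : ℝ => a / (1 - (b - a) / b * z ^ 2) - ν) '' Set.Ioo 0 1 = Set.Ioo (a - ν) (b - ν) := by
  have hb : 0 < b := ha.trans hab
  have hba : 0 < b - a := sub_pos.2 hab
  ext x
  constructor
  · rintro ⟨z, ⟨hz0, hz1⟩, rfl⟩
    have hz2 : 0 < z ^ 2 := by positivity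
    have hz3 : z ^ 2 < 1 := by nlinarith
    have hρ : 0 < (b - a) / b := by positivity
    have hD : 0 < 1 - (b - a) / b * z ^ 2 := by
      have : (b - a) / b < 1 := by rw [div_lt_one hb]; linarith
      nlinarith
    constructor
    · have : a < a / (1 - (b - a) / b * z ^ 2) := by
        rw [lt_div_iff₀ hD]
        nlinarith [mul_pos ha (mul_pos hρ hz2)]
      simpa using this
    · have : a / (1 - (b - a) / b * z ^ 2) < b := by
        rw [div_lt_iff₀ hD]
        have : b * (1 - (b - a) / b * z ^ 2) = b - (b - a) * z ^ 2 := by field_simp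
        nlinarith
      simpa using this
  · rintro ⟨h1, h2⟩
    have hx : 0 < x + ν := by linarith
    have hxa : 0 < x + ν - a := by linarith
    have hq : 0 < b * (x + ν - a) / ((b - a) * (x + ν)) := by positivity
    refine ⟨√(b * (x + ν - a) / ((b - a) * (x + ν))), ⟨Real.sqrt_pos.2 hq, ?_⟩, ?_⟩
    · rw [Real.sqrt_lt' one_pos, one_pow, div_lt_one (by positivity)]
      nlinarith
    · have : 1 - (b - a) / b * (b * (x + ν - a) / ((b - a) * (x + ν))) = a / (x + ν) := by
        field_simp
        ring
      simp only [Real.sq_sqrt hq.le, this]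
      field_simp
      ring

/-- Reduction of `∫ x dx / √(x (c - x) (b - x) (x - a))` over `(a, b)`, written in the shifted
variable `ξ = x - ν`, to the complete elliptic integral of the third kind. -/
lemma integral_third_kind_eq {a b c ν s ρ : ℝ} (ha : 0 < a) (hab : a < b) (hbc : b < c)
    (hs : s ^ 2 = c * (b - a) / (b * (c - a))) (hρ : ρ = (b - a) / b) :
    (∫ ξ in (a - ν)..(b - ν), (ξ + ν) /
        √((ξ + ν) * (c - ν - ξ) * (b - ν - ξ) * (ξ - (a - ν))))
      = 2 * a * (∫ z in (0 : ℝ)..1, 1 / ((1 - ρ * z ^ 2) * √((1 - z ^ 2) * (1 - s ^ 2 * z ^ 2))))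
          / √(b * (c - a)) := by
  have hb : 0 < b := ha.trans hab
  have hba : 0 < b - a := sub_pos.2 hab
  have hca : 0 < c - a := by linarith
  have hρ0 : 0 < ρ := by rw [hρ]; positivity
  have hρ1 : ρ < 1 := by rw [hρ, div_lt_one hb]; linarith
  have hD : ∀ z ∈ Set.Ioo (0 : ℝ) 1, 0 < 1 - ρ * z ^ 2 := fun z hz => by
    have : z ^ 2 < 1 := by nlinarith [hz.1, hz.2]
    nlinarith
  have hderiv : ∀ z ∈ Set.Ioo (0 : ℝ) 1, HasDerivWithinAt (fun z : ℝ => a / (1 - ρ * z ^ 2) - ν)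
      (2 * a * ρ * z / (1 - ρ * z ^ 2) ^ 2) (Set.Ioo 0 1) z := fun z hz => by
    have h : HasDerivAt (fun z : ℝ => 1 - ρ * z ^ 2) (-(ρ * (2 * z))) z := by
      simpa using ((hasDerivAt_pow 2 z).const_mul ρ).const_sub 1
    have h' := (((hasDerivAt_const z a).div h (hD z hz).ne').sub_const ν).hasDerivWithinAt
      (s := Set.Ioo 0 1)
    exact h'.congr_deriv (by ring)
  have hinj : Set.InjOn (fun z : ℝ => a / (1 - ρ * z ^ 2) - ν) (Set.Ioo 0 1) := by
    intro z hz w hw h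
    have h1 : a / (1 - ρ * z ^ 2) = a / (1 - ρ * w ^ 2) := by simpa using h
    rw [div_eq_div_iff (hD z hz).ne' (hD w hw).ne'] at h1
    have h2 : z ^ 2 = w ^ 2 := by
      have := mul_left_cancel₀ ha.ne' h1
      exact mul_left_cancel₀ hρ0.ne' (by linarith)
    exact (pow_left_inj₀ hz.1.le hw.1.le two_ne_zero).1 h2
  rw [intervalIntegral.integral_of_le (by linarith), intervalIntegral.integral_of_le zero_le_one,
    MeasureTheory.integral_Ioc_eq_integral_Ioo, MeasureTheory.integral_Ioc_eq_integral_Ioo,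
    ← image_div_one_sub_mul_sq_Ioo ha hab ν, ← hρ,
    MeasureTheory.integral_image_eq_integral_abs_deriv_smul measurableSet_Ioo hderiv hinj,
    mul_div_right_comm, ← MeasureTheory.integral_const_mul]
  refine MeasureTheory.setIntegral_congr_fun measurableSet_Ioo fun z hz => ?_
  have hDz := hD z hz
  have hz0 := hz.1
  have hcx : c - a / (1 - ρ * z ^ 2) = (c - a) * (1 - s ^ 2 * z ^ 2) / (1 - ρ * z ^ 2) := by
    have : (c - a) * (1 - s ^ 2 * z ^ 2) = c * (1 - ρ * z ^ 2) - a := by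
      rw [hs, hρ]
      field_simp
      ring
    rw [this]
    field_simp
  have hbx : b - a / (1 - ρ * z ^ 2) = b * ρ * (1 - z ^ 2) / (1 - ρ * z ^ 2) := by
    have : b * ρ * (1 - z ^ 2) = b * (1 - ρ * z ^ 2) - a := by
      rw [hρ]
      field_simp
      ring
    rw [this]
    field_simp
  have hxa : a / (1 - ρ * z ^ 2) - a = a * ρ * z ^ 2 / (1 - ρ * z ^ 2) := by
    field_simp
    ring
  have hprod : (a / (1 - ρ * z ^ 2) - ν + ν) * (c - ν - (a / (1 - ρ * z ^ 2) - ν)) *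
      (b - ν - (a / (1 - ρ * z ^ 2) - ν)) * (a / (1 - ρ * z ^ 2) - ν - (a - ν)) =
      (a * ρ * z / (1 - ρ * z ^ 2) ^ 2) ^ 2 *
        ((b * (c - a)) * ((1 - z ^ 2) * (1 - s ^ 2 * z ^ 2))) := by
    rw [sub_add_cancel, sub_sub_sub_cancel_right, sub_sub_sub_cancel_right,
      sub_sub_sub_cancel_right, hcx, hbx, hxa]
    field_simp
  have hroot : 0 < √(b * (c - a)) := Real.sqrt_pos.2 (by positivity)
  have hpos : 0 < a * ρ * z / (1 - ρ * z ^ 2) ^ 2 := by positivity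
  have habs : 0 < 2 * a * ρ * z / (1 - ρ * z ^ 2) ^ 2 := by positivity
  simp only [smul_eq_mul]
  rw [hprod, Real.sqrt_mul (sq_nonneg _), Real.sqrt_sq hpos.le,
    Real.sqrt_mul (by positivity : 0 ≤ b * (c - a)), abs_of_pos habs, sub_add_cancel]
  field_simp

/-- the a-period of the differential `(ξ+ν)dξ/w` equals
`2(β₃+ν)Λ(s,ρ)/√((β₂+ν)(β₁−β₃))`, where `Λ(s,ρ) = ∫₀¹ dz/((1−ρz²)√((1−z²)(1−s²z²)))`
is the complete elliptic integral of the third kind, with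
`s² = (β₁+ν)(β₂−β₃)/((β₂+ν)(β₁−β₃))` and `ρ = (β₂−β₃)/(β₂+ν)`. Equivalently, the
wave number `k = 2π/(2∫_{β₃}^{β₂}(ξ+ν)dξ/w)` equals `π√((β₂+ν)(β₁−β₃))/(2(β₃+ν)Λ(s,ρ))`. -/
theorem a_period_third_kind_and_wave_number
    (ν β₁ β₂ β₃ : ℝ) (h3 : -ν < β₃) (h32 : β₃ < β₂) (h21 : β₂ < β₁)
    (s ρ : ℝ) (hs : s ^ 2 = (β₁ + ν) * (β₂ - β₃) / ((β₂ + ν) * (β₁ - β₃)))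
    (hρ : ρ = (β₂ - β₃) / (β₂ + ν)) :
    (∫ ξ in β₃..β₂,
        (ξ + ν) / Real.sqrt ((ξ + ν) * (β₁ - ξ) * (β₂ - ξ) * (ξ - β₃)))
      = 2 * (β₃ + ν)
          * (∫ z in (0:ℝ)..1,
              1 / ((1 - ρ * z ^ 2) * Real.sqrt ((1 - z ^ 2) * (1 - s ^ 2 * z ^ 2))))
          / Real.sqrt ((β₂ + ν) * (β₁ - β₃))
    ∧ 2 * Real.pi
        / (2 * ∫ ξ in β₃..β₂,
            (ξ + ν) / Real.sqrt ((ξ + ν) * (β₁ - ξ) * (β₂ - ξ) * (ξ - β₃)))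
      = Real.pi * Real.sqrt ((β₂ + ν) * (β₁ - β₃))
          / (2 * (β₃ + ν)
              * ∫ z in (0:ℝ)..1,
                  1 / ((1 - ρ * z ^ 2) * Real.sqrt ((1 - z ^ 2) * (1 - s ^ 2 * z ^ 2)))) := by
  have key := integral_third_kind_eq (a := β₃ + ν) (b := β₂ + ν) (c := β₁ + ν) (ν := ν) (s := s)
    (ρ := ρ) (by linarith) (by linarith) (by linarith)
    (by simpa only [add_sub_add_right_eq_sub] using hs)
    (by simpa only [add_sub_add_right_eq_sub] using hρ)
  simp only [add_sub_cancel_right, add_sub_add_right_eq_sub] at key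
  refine ⟨key, ?_⟩
  rw [key, mul_div_mul_left _ _ two_ne_zero, div_div_eq_mul_div]
end

section
/- Let ν ∈ ℝ and −ν < β₃ < β₂ < β₁. Set s² := (β₁+ν)(β₂−β₃)/((β₂+ν)(β₁−β₃)) and c₁ := √((β₂+ν)/(β₁+ν)). Then the improper integral ∫_{β₁}^{∞} dξ/√((ξ+ν)(ξ−β₁)(ξ−β₂)(ξ−β₃)) converges and equals (2/√((β₂+ν)(β₁−β₃))) ∫₀^{c₁} dz/√((1−z²)(1−s²z²)). -/
open Real intervalIntegral MeasureTheory

/-- The map `z ↦ β + d z² / (c² - z²)` has derivative `2 d c² z / (c² - z²)²`. -/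
theorem hasDerivAt_add_mul_sq_div_sub_sq (β d c z : ℝ) (hz : c ^ 2 - z ^ 2 ≠ 0) :
    HasDerivAt (fun z : ℝ => β + d * z ^ 2 / (c ^ 2 - z ^ 2))
      (2 * d * c ^ 2 * z / (c ^ 2 - z ^ 2) ^ 2) z := by
  have hsq : HasDerivAt (fun z : ℝ => z ^ 2) (2 * z) z := by
    simpa using hasDerivAt_pow 2 z
  refine (((hsq.const_mul d).fun_div (hsq.const_sub (c ^ 2)) hz).const_add β).congr_deriv ?_
  congr 1
  ring

/-- The map `z ↦ β + d z² / (c² - z²)` is injective on `(0, c)`. -/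
theorem injOn_add_mul_sq_div_sub_sq (β : ℝ) {d c : ℝ} (hd : 0 < d) :
    Set.InjOn (fun z : ℝ => β + d * z ^ 2 / (c ^ 2 - z ^ 2)) (Set.Ioo 0 c) := by
  rintro x ⟨hx0, hxc⟩ y ⟨hy0, hyc⟩ hxy
  have hx : c ^ 2 - x ^ 2 ≠ 0 := by nlinarith
  have hy : c ^ 2 - y ^ 2 ≠ 0 := by nlinarith
  have hc : 0 < c := hx0.trans hxc
  have hdiv : d * x ^ 2 / (c ^ 2 - x ^ 2) = d * y ^ 2 / (c ^ 2 - y ^ 2) := add_left_cancel hxy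
  rw [div_eq_div_iff hx hy] at hdiv
  have hsq : d * c ^ 2 * (x ^ 2) = d * c ^ 2 * (y ^ 2) := by linear_combination hdiv
  exact (pow_left_inj₀ hx0.le hy0.le two_ne_zero).1 (mul_left_cancel₀ (by positivity) hsq)

/-- The map `z ↦ β + d z² / (c² - z²)` sends `(0, c)` onto `(β, ∞)`. -/
theorem image_add_mul_sq_div_sub_sq (β : ℝ) {d c : ℝ} (hd : 0 < d) (hc : 0 < c) :
    (fun z : ℝ => β + d * z ^ 2 / (c ^ 2 - z ^ 2)) '' Set.Ioo 0 c = Set.Ioi β := by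
  ext ξ
  constructor
  · rintro ⟨z, ⟨hz0, hzc⟩, rfl⟩
    have hz : 0 < c ^ 2 - z ^ 2 := by nlinarith
    have : 0 < d * z ^ 2 / (c ^ 2 - z ^ 2) := by positivity
    simpa using this
  · intro hξ
    have ht : 0 < ξ - β := sub_pos.2 hξ
    have hq : (√((ξ - β) / (ξ - β + d))) ^ 2 = (ξ - β) / (ξ - β + d) := sq_sqrt (by positivity)
    refine ⟨c * √((ξ - β) / (ξ - β + d)), ⟨by positivity, ?_⟩, ?_⟩
    · have : √((ξ - β) / (ξ - β + d)) < 1 := by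
        rw [sqrt_lt' one_pos, one_pow, div_lt_one (by positivity)]
        linarith
      nlinarith
    · have hden : c ^ 2 - c ^ 2 * ((ξ - β) / (ξ - β + d)) = c ^ 2 * d / (ξ - β + d) := by
        field_simp
        ring
      simp only [mul_pow, hq, hden]
      field_simp
      ring

/-- The pullback of `dξ / √((ξ+ν)(ξ-β₁)(ξ-β₂)(ξ-β₃))` under
`ξ = β₁ + (β₁-β₂) z² / (c² - z²)` is a multiple of Legendre's differential. -/
theorem deriv_mul_one_div_sqrt_quartic {ν β₁ β₂ β₃ s c z : ℝ}
    (h3 : -ν < β₃) (h32 : β₃ < β₂) (h21 : β₂ < β₁)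
    (hs : s ^ 2 = (β₁ + ν) * (β₂ - β₃) / ((β₂ + ν) * (β₁ - β₃)))
    (hc : c ^ 2 = (β₂ + ν) / (β₁ + ν)) (hz : z ∈ Set.Ioo 0 c) {ξ : ℝ}
    (hξ : ξ = β₁ + (β₁ - β₂) * z ^ 2 / (c ^ 2 - z ^ 2)) :
    |2 * (β₁ - β₂) * c ^ 2 * z / (c ^ 2 - z ^ 2) ^ 2| *
        (1 / √((ξ + ν) * (ξ - β₁) * (ξ - β₂) * (ξ - β₃))) =
      2 / √((β₂ + ν) * (β₁ - β₃)) * (1 / √((1 - z ^ 2) * (1 - s ^ 2 * z ^ 2))) := by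
  obtain ⟨hz0, hzc⟩ := hz
  have ha : 0 < β₁ + ν := by linarith
  have hb : 0 < β₂ + ν := by linarith
  have hd : 0 < β₁ - β₂ := by linarith
  have hf : 0 < β₁ - β₃ := by linarith
  have hk : 0 < c ^ 2 - z ^ 2 := by nlinarith
  have hc0 : 0 < c := hz0.trans hzc
  have hac : (β₁ + ν) * c ^ 2 = β₂ + ν := by rw [hc]; field_simp
  have hsc : s ^ 2 * (c ^ 2 * (β₁ - β₃)) = β₂ - β₃ := by rw [hs, hc]; field_simp
  have e₁ : ξ - β₁ = (β₁ - β₂) * z ^ 2 / (c ^ 2 - z ^ 2) := by rw [hξ]; ring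
  have e₂ : ξ - β₂ = (β₁ - β₂) * c ^ 2 / (c ^ 2 - z ^ 2) := by
    rw [hξ]; field_simp; ring
  have e₃ : ξ - β₃ = (β₁ - β₃) * c ^ 2 * (1 - s ^ 2 * z ^ 2) / (c ^ 2 - z ^ 2) := by
    rw [hξ, eq_div_iff hk.ne', sub_mul, add_mul, div_mul_cancel₀ _ hk.ne']
    linear_combination z ^ 2 * hsc
  have e₄ : ξ + ν = (β₂ + ν) * (1 - z ^ 2) / (c ^ 2 - z ^ 2) := by
    rw [hξ, eq_div_iff hk.ne', add_mul, add_mul, div_mul_cancel₀ _ hk.ne']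
    linear_combination hac
  have hprod : (ξ + ν) * (ξ - β₁) * (ξ - β₂) * (ξ - β₃) =
      ((β₁ - β₂) * c ^ 2 * z / (c ^ 2 - z ^ 2) ^ 2) ^ 2 *
        (((β₂ + ν) * (β₁ - β₃)) * ((1 - z ^ 2) * (1 - s ^ 2 * z ^ 2))) := by
    rw [e₁, e₂, e₃, e₄]; field_simp
  have hJ : 0 < (β₁ - β₂) * c ^ 2 * z / (c ^ 2 - z ^ 2) ^ 2 := by positivity
  have h2J : 2 * (β₁ - β₂) * c ^ 2 * z / (c ^ 2 - z ^ 2) ^ 2 =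
      2 * ((β₁ - β₂) * c ^ 2 * z / (c ^ 2 - z ^ 2) ^ 2) := by ring
  rw [hprod, sqrt_mul (sq_nonneg _), sqrt_sq hJ.le, sqrt_mul (by positivity), h2J,
    abs_of_pos (by positivity)]
  generalize (β₁ - β₂) * c ^ 2 * z / (c ^ 2 - z ^ 2) ^ 2 = J at hJ
  rw [mul_one_div, mul_comm 2 J, mul_div_mul_left _ _ hJ.ne', div_mul_div_comm, mul_one]

/-- Legendre's integrand is continuous on `[0, c]` as long as `c² < 1` and `s² c² < 1`. -/
theorem continuousOn_one_div_sqrt_legendre {s c : ℝ} (hc : c ^ 2 < 1) (hsc : s ^ 2 * c ^ 2 < 1) :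
    ContinuousOn (fun z : ℝ => 1 / √((1 - z ^ 2) * (1 - s ^ 2 * z ^ 2))) (Set.Icc 0 c) := by
  refine continuousOn_const.div (by fun_prop) fun z hz => (sqrt_pos.2 ?_).ne'
  have hzc : z ^ 2 ≤ c ^ 2 := pow_le_pow_left₀ hz.1 hz.2 2
  have hszc : s ^ 2 * z ^ 2 ≤ s ^ 2 * c ^ 2 := mul_le_mul_of_nonneg_left hzc (sq_nonneg s)
  exact mul_pos (by linarith) (by linarith)

/-- the improper integral `∫_{β₁}^{∞} dξ/√((ξ+ν)(ξ−β₁)(ξ−β₂)(ξ−β₃))`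
converges and equals `(2/√((β₂+ν)(β₁−β₃))) ∫₀^{c₁} dz/√((1−z²)(1−s²z²))`, where
`c₁ = √((β₂+ν)/(β₁+ν))` and `s² = (β₁+ν)(β₂−β₃)/((β₂+ν)(β₁−β₃))`. -/
theorem integral_Ioi_reduces_to_incomplete_elliptic
    (ν β₁ β₂ β₃ : ℝ) (h3 : -ν < β₃) (h32 : β₃ < β₂) (h21 : β₂ < β₁)
    (s c₁ : ℝ) (hs : s ^ 2 = (β₁ + ν) * (β₂ - β₃) / ((β₂ + ν) * (β₁ - β₃)))
    (hc₁ : c₁ = Real.sqrt ((β₂ + ν) / (β₁ + ν))) :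
    IntegrableOn
        (fun ξ => 1 / Real.sqrt ((ξ + ν) * (ξ - β₁) * (ξ - β₂) * (ξ - β₃)))
        (Set.Ioi β₁)
    ∧ (∫ ξ in Set.Ioi β₁,
          1 / Real.sqrt ((ξ + ν) * (ξ - β₁) * (ξ - β₂) * (ξ - β₃)))
        = (2 / Real.sqrt ((β₂ + ν) * (β₁ - β₃)))
            * ∫ z in (0:ℝ)..c₁, 1 / Real.sqrt ((1 - z ^ 2) * (1 - s ^ 2 * z ^ 2)) := by
  have ha : 0 < β₁ + ν := by linarith
  have hb : 0 < β₂ + ν := by linarith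
  have hd : 0 < β₁ - β₂ := by linarith
  have hf : 0 < β₁ - β₃ := by linarith
  have hc0 : 0 < c₁ := by rw [hc₁]; positivity
  have hcsq : c₁ ^ 2 = (β₂ + ν) / (β₁ + ν) := by rw [hc₁, sq_sqrt (by positivity)]
  have hc1 : c₁ ^ 2 < 1 := by rw [hcsq, div_lt_one ha]; linarith
  have hsc : s ^ 2 * c₁ ^ 2 < 1 := by
    have : s ^ 2 * c₁ ^ 2 = (β₂ - β₃) / (β₁ - β₃) := by rw [hs, hcsq]; field_simp
    rw [this, div_lt_one hf]
    linarith
  have hderiv : ∀ z ∈ Set.Ioo 0 c₁,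
      HasDerivWithinAt (fun z : ℝ => β₁ + (β₁ - β₂) * z ^ 2 / (c₁ ^ 2 - z ^ 2))
        (2 * (β₁ - β₂) * c₁ ^ 2 * z / (c₁ ^ 2 - z ^ 2) ^ 2) (Set.Ioo 0 c₁) z := fun z hz =>
    (hasDerivAt_add_mul_sq_div_sub_sq _ _ _ _ (by nlinarith [hz.1, hz.2])).hasDerivWithinAt
  have hinj := injOn_add_mul_sq_div_sub_sq β₁ (c := c₁) hd
  have hpull := fun z (hz : z ∈ Set.Ioo 0 c₁) =>
    deriv_mul_one_div_sqrt_quartic h3 h32 h21 hs hcsq hz rfl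
  rw [← image_add_mul_sq_div_sub_sq β₁ hd hc0]
  constructor
  · rw [integrableOn_image_iff_integrableOn_abs_deriv_smul measurableSet_Ioo hderiv hinj]
    refine IntegrableOn.congr_fun ?_ (fun z hz => (hpull z hz).symm) measurableSet_Ioo
    exact (((continuousOn_one_div_sqrt_legendre hc1 hsc).integrableOn_Icc).mono_set
      Set.Ioo_subset_Icc_self).const_mul _
  · rw [integral_image_eq_integral_abs_deriv_smul measurableSet_Ioo hderiv hinj,
      integral_of_le hc0.le, integral_Ioc_eq_integral_Ioo,
      ← MeasureTheory.integral_const_mul]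
    exact setIntegral_congr_fun measurableSet_Ioo hpull
end

section
/- Let f : ℝ → ℝ be continuously differentiable. Define Q(u,v) := (√2/4) ∫_{−1}^{1} f(((1+μ)/2)v + ((1−μ)/2)u)/√(1−μ) dμ for u,v ∈ ℝ. Then for all u, v ∈ ℝ: f(u) = Q(u,v) + 2(u−v) ∂Q/∂u (u,v). -/
open Real intervalIntegral

/-- The map `s ↦ 1 - 2 s²` sends `(0, 1)` onto `(-1, 1)`. -/
lemma image_one_sub_two_mul_sq_Ioo :
    (fun s : ℝ => 1 - 2 * s ^ 2) '' Set.Ioo 0 1 = Set.Ioo (-1) 1 := by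
  ext x
  constructor
  · rintro ⟨s, ⟨hs0, hs1⟩, rfl⟩
    constructor <;> dsimp only <;> nlinarith
  · rintro ⟨hx0, hx1⟩
    refine ⟨√((1 - x) / 2), ⟨Real.sqrt_pos.mpr (by linarith), ?_⟩, ?_⟩
    · rw [Real.sqrt_lt' one_pos]
      linarith
    · dsimp only
      rw [Real.sq_sqrt (by linarith)]
      ring

/-- The substitution `μ = 1 - 2 s²` removes the singular weight `1 / √(1 - μ)`. -/
lemma integral_div_sqrt_one_sub (g : ℝ → ℝ) :
    √2 / 4 * ∫ μ in (-1 : ℝ)..1, g μ / √(1 - μ) = ∫ s in (0 : ℝ)..1, g (1 - 2 * s ^ 2) := by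
  have hderiv : ∀ s ∈ Set.Ioo (0 : ℝ) 1,
      HasDerivWithinAt (fun s : ℝ => 1 - 2 * s ^ 2) (-(4 * s)) (Set.Ioo 0 1) s := by
    intro s _
    refine HasDerivAt.hasDerivWithinAt ?_
    convert ((hasDerivAt_pow 2 s).const_mul 2).const_sub 1 using 1
    norm_num
    ring
  have hinj : Set.InjOn (fun s : ℝ => 1 - 2 * s ^ 2) (Set.Ioo 0 1) := by
    intro s hs t ht hst
    dsimp only at hst
    exact (pow_left_inj₀ hs.1.le ht.1.le two_ne_zero).mp (by linarith)
  rw [integral_of_le (by norm_num), integral_of_le (by norm_num),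
    MeasureTheory.integral_Ioc_eq_integral_Ioo, MeasureTheory.integral_Ioc_eq_integral_Ioo,
    ← image_one_sub_two_mul_sq_Ioo,
    MeasureTheory.integral_image_eq_integral_abs_deriv_smul measurableSet_Ioo hderiv hinj,
    ← MeasureTheory.integral_const_mul]
  refine MeasureTheory.setIntegral_congr_fun measurableSet_Ioo fun s hs => ?_
  have hs0 : s ≠ 0 := hs.1.ne'
  have hsqrt : √(1 - (1 - 2 * s ^ 2)) = √2 * s := by
    rw [sub_sub_cancel, Real.sqrt_mul zero_le_two, Real.sqrt_sq hs.1.le]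
  rw [hsqrt, abs_neg, abs_of_pos (mul_pos four_pos hs.1), smul_eq_mul]
  field_simp

/-- Differentiation under the integral sign for `u ↦ ∫₀¹ f (v + s² (u - v)) ds`. -/
lemma hasDerivAt_integral_comp_add_sq_mul_sub {f : ℝ → ℝ} (hf : ContDiff ℝ 1 f) (u v : ℝ) :
    HasDerivAt (fun u' => ∫ s in (0 : ℝ)..1, f (v + s ^ 2 * (u' - v)))
      (∫ s in (0 : ℝ)..1, deriv f (v + s ^ 2 * (u - v)) * s ^ 2) u := by
  have hc : Continuous f := hf.continuous
  have hc' : Continuous (deriv f) := hf.continuous_deriv le_rfl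
  obtain ⟨C, hC⟩ := ((isCompact_closedBall u 1).prod (isCompact_Icc (a := (0 : ℝ)) (b := 1)))
    |>.exists_bound_of_continuousOn
      (f := fun p : ℝ × ℝ => deriv f (v + p.2 ^ 2 * (p.1 - v)) * p.2 ^ 2)
      (by fun_prop)
  refine (intervalIntegral.hasDerivAt_integral_of_dominated_loc_of_deriv_le (bound := fun _ => C)
    (F := fun u' s => f (v + s ^ 2 * (u' - v)))
    (F' := fun u' s => deriv f (v + s ^ 2 * (u' - v)) * s ^ 2)
    (Metric.closedBall_mem_nhds u one_pos) ?_ ?_ ?_ ?_ ?_ ?_).2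
  · exact .of_forall fun x => Continuous.aestronglyMeasurable (by fun_prop)
  · exact Continuous.intervalIntegrable (by fun_prop) _ _
  · exact Continuous.aestronglyMeasurable (by fun_prop)
  · refine .of_forall fun s hs x hx => hC (x, s) ⟨hx, ?_⟩
    rw [Set.uIoc_of_le zero_le_one] at hs
    exact Set.Ioc_subset_Icc_self hs
  · exact intervalIntegrable_const
  · refine .of_forall fun s _ x _ => ?_
    have hlin : HasDerivAt (fun x => v + s ^ 2 * (x - v)) (s ^ 2) x := by
      simpa using (((hasDerivAt_id x).sub_const v).const_mul (s ^ 2)).const_add v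
    exact ((hf.differentiable one_ne_zero).differentiableAt.hasDerivAt).comp x hlin

/-- The fundamental theorem of calculus for `s ↦ s f (v + s² (u - v))` on `[0, 1]`. -/
lemma integral_add_two_mul_sub_integral_deriv {f : ℝ → ℝ} (hf : ContDiff ℝ 1 f) (u v : ℝ) :
    (∫ s in (0 : ℝ)..1, f (v + s ^ 2 * (u - v)))
      + 2 * (u - v) * ∫ s in (0 : ℝ)..1, deriv f (v + s ^ 2 * (u - v)) * s ^ 2 = f u := by
  have hc : Continuous f := hf.continuous
  have hc' : Continuous (deriv f) := hf.continuous_deriv le_rfl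
  rw [← integral_const_mul, ← integral_add
    (Continuous.intervalIntegrable (by fun_prop) _ _)
    (Continuous.intervalIntegrable (by fun_prop) _ _),
    integral_eq_sub_of_hasDerivAt (f := fun s => s * f (v + s ^ 2 * (u - v))) ?_
      (Continuous.intervalIntegrable (by fun_prop) _ _)]
  · simp
  · intro s _
    have hinner : HasDerivAt (fun s => v + s ^ 2 * (u - v)) (2 * s * (u - v)) s := by
      simpa using ((hasDerivAt_pow 2 s).mul_const (u - v)).const_add v
    have hcomp : HasDerivAt (fun s => f (v + s ^ 2 * (u - v))) _ s :=
      ((hf.differentiable one_ne_zero).differentiableAt.hasDerivAt).comp s hinner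
    refine ((hasDerivAt_id s).fun_mul hcomp).congr_deriv ?_
    simp only [id]
    ring

/-- for `f ∈ C¹` and
`Q(u,v) = (√2/4)∫_{−1}^{1} f(((1+μ)/2)v + ((1−μ)/2)u)/√(1−μ) dμ`, one has
`f(u) = Q(u,v) + 2(u−v)∂_u Q(u,v)`. -/
theorem f_eq_Q_add_two_mul_sub_deriv
    (f : ℝ → ℝ) (hf : ContDiff ℝ 1 f)
    (Q : ℝ → ℝ → ℝ)
    (hQ : ∀ u v : ℝ, Q u v
      = (Real.sqrt 2 / 4)
          * ∫ μ in (-1:ℝ)..1,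
              f ((1 + μ) / 2 * v + (1 - μ) / 2 * u) / Real.sqrt (1 - μ)) :
    ∀ u v : ℝ, f u = Q u v + 2 * (u - v) * deriv (fun u' => Q u' v) u := by
  intro u v
  have hQ' : ∀ u', Q u' v = ∫ s in (0 : ℝ)..1, f (v + s ^ 2 * (u' - v)) := by
    intro u'
    rw [hQ, integral_div_sqrt_one_sub fun μ => f ((1 + μ) / 2 * v + (1 - μ) / 2 * u')]
    refine integral_congr fun s _ => congrArg f ?_
    ring
  simp only [hQ', (hasDerivAt_integral_comp_add_sq_mul_sub hf u v).deriv]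
  exact (integral_add_two_mul_sub_integral_deriv hf u v).symm
end

section
/- Let f : ℝ → ℝ be twice continuously differentiable. Define Q(u,v) := (√2/4) ∫_{−1}^{1} f(((1+μ)/2)v + ((1−μ)/2)u)/√(1−μ) dμ. Then for all u, v ∈ ℝ with u ≠ v: ∂²Q/∂u∂v (u,v) = (2 ∂Q/∂u (u,v) − ∂Q/∂v (u,v)) / (2(u−v)). -/
open Real intervalIntegral

open MeasureTheory Set

/-- The Jacobi weight `(1 - μ)^(-1/2)` is integrable on `[-1, 1]`. -/
lemma intervalIntegrable_inv_sqrt_one_sub :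
    IntervalIntegrable (fun μ : ℝ => (√(1 - μ))⁻¹) volume (-1) 1 := by
  refine intervalIntegrable_deriv_of_nonneg (g := fun μ : ℝ => -2 * √(1 - μ))
    (by fun_prop) ?_ fun _ _ => by positivity
  intro μ hμ
  norm_num at hμ
  have h1 : 1 - μ ≠ 0 := by linarith
  refine ((((hasDerivAt_id' μ).const_sub 1).sqrt h1).const_mul (-2)).congr_deriv ?_
  field_simp

/-- Differentiation under the integral sign on a compact interval, for a jointly continuous
function with jointly continuous derivative, against an integrable weight. -/
lemma hasDerivAt_integral_mul_weight {G G' : ℝ → ℝ → ℝ} {W : ℝ → ℝ} {a b : ℝ}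
    (hG : Continuous (Function.uncurry G)) (hG' : Continuous (Function.uncurry G'))
    (hd : ∀ t μ, HasDerivAt (fun s => G s μ) (G' t μ) t)
    (hW : IntervalIntegrable W volume a b) (t : ℝ) :
    HasDerivAt (fun s => ∫ μ in a..b, G s μ * W μ) (∫ μ in a..b, G' t μ * W μ) t := by
  have hc : ∀ s, Continuous (G s) := fun s => hG.comp (by fun_prop : Continuous fun μ => (s, μ))
  have hc' : ∀ s, Continuous (G' s) := fun s =>
    hG'.comp (by fun_prop : Continuous fun μ => (s, μ))
  obtain ⟨C, hC⟩ := ((isCompact_closedBall t 1).prod (isCompact_uIcc (a := a) (b := b)))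
    |>.exists_bound_of_continuousOn hG'.continuousOn
  refine (intervalIntegral.hasDerivAt_integral_of_dominated_loc_of_deriv_le
    (F := fun s μ => G s μ * W μ) (F' := fun s μ => G' s μ * W μ)
    (bound := fun μ => C * ‖W μ‖)
    (Metric.ball_mem_nhds t one_pos) ?_ ?_ ?_ ?_ ?_ ?_).2
  · exact .of_forall fun s => (hW.continuousOn_mul (hc s).continuousOn).def'.aestronglyMeasurable
  · exact hW.continuousOn_mul (hc t).continuousOn
  · exact (hW.continuousOn_mul (hc' t).continuousOn).def'.aestronglyMeasurable
  · refine .of_forall fun μ hμ s hs => ?_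
    rw [norm_mul]
    gcongr
    exact hC (s, μ) ⟨Metric.ball_subset_closedBall hs, uIoc_subset_uIcc hμ⟩
  · exact hW.norm.const_mul C
  · exact .of_forall fun μ _ s _ => (hd s μ).mul_const _

/-- Integration by parts against `(1 + μ) √(1 - μ)`, which vanishes at both endpoints. -/
lemma integral_one_sub_sq_mul_deriv {g g' : ℝ → ℝ} (hg : Continuous g) (hg' : Continuous g')
    (hd : ∀ μ, HasDerivAt g (g' μ) μ) :
    ∫ μ in (-1 : ℝ)..1, (1 + μ) * (1 - μ) * g' μ * (√(1 - μ))⁻¹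
      = ∫ μ in (-1 : ℝ)..1, ((1 + μ) / 2 - (1 - μ)) * g μ * (√(1 - μ))⁻¹ := by
  have hW := intervalIntegrable_inv_sqrt_one_sub
  have hi : IntervalIntegrable
      (fun μ => (1 + μ) * (1 - μ) * g' μ * (√(1 - μ))⁻¹) volume (-1) 1 :=
    hW.continuousOn_mul (by fun_prop)
  have hj : IntervalIntegrable
      (fun μ => ((1 + μ) / 2 - (1 - μ)) * g μ * (√(1 - μ))⁻¹) volume (-1) 1 :=
    hW.continuousOn_mul (by fun_prop)
  rw [← sub_eq_zero, ← integral_sub hi hj,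
    integral_eq_sub_of_hasDerivAt_of_le (f := fun μ => (1 + μ) * √(1 - μ) * g μ)
      (by norm_num) (by fun_prop) ?_ (hi.sub hj)]
  · simp
  · intro μ hμ
    have h1 : 0 < 1 - μ := by linarith [hμ.2]
    have hs : √(1 - μ) ^ 2 = 1 - μ := Real.sq_sqrt h1.le
    have hs0 : √(1 - μ) ≠ 0 := (Real.sqrt_pos.2 h1).ne'
    refine ((((hasDerivAt_id' μ).const_add 1).mul
      (((hasDerivAt_id' μ).const_sub 1).sqrt h1.ne')).mul (hd μ)).congr_deriv ?_
    simp only [Pi.mul_apply]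
    field_simp
    rw [hs]
    ring

/-- for `f ∈ C²` and
`Q(u,v) = (√2/4)∫_{−1}^{1} f(((1+μ)/2)v + ((1−μ)/2)u)/√(1−μ) dμ`, one has, for `u ≠ v`,
`∂²Q/∂u∂v = (2∂_u Q − ∂_v Q)/(2(u−v))`. -/
theorem Q_mixed_second_derivative_identity
    (f : ℝ → ℝ) (hf : ContDiff ℝ 2 f)
    (Q : ℝ → ℝ → ℝ)
    (hQ : ∀ u v : ℝ, Q u v
      = (Real.sqrt 2 / 4)
          * ∫ μ in (-1:ℝ)..1,
              f ((1 + μ) / 2 * v + (1 - μ) / 2 * u) / Real.sqrt (1 - μ)) :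
    ∀ u v : ℝ, u ≠ v →
      deriv (fun v' => deriv (fun u' => Q u' v') u) v
        = (2 * deriv (fun u' => Q u' v) u - deriv (fun v' => Q u v') v)
            / (2 * (u - v)) := by
  intro u v huv
  have hW := intervalIntegrable_inv_sqrt_one_sub
  have hf1 : ContDiff ℝ 1 (deriv f) := ((contDiff_succ_iff_deriv (n := 1)).1 hf).2.2
  have c0 : Continuous f := hf.continuous
  have c1 : Continuous (deriv f) := hf1.continuous
  have c2 : Continuous (deriv (deriv f)) := hf1.continuous_deriv le_rfl
  have d0 : ∀ x, HasDerivAt f (deriv f x) x := fun x =>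
    (hf.differentiable (by norm_num) x).hasDerivAt
  have d1 : ∀ x, HasDerivAt (deriv f) (deriv (deriv f) x) x := fun x =>
    (hf1.differentiable (by norm_num) x).hasDerivAt
  have lin_u : ∀ v μ t : ℝ, HasDerivAt (fun s => (1 + μ) / 2 * v + (1 - μ) / 2 * s)
      ((1 - μ) / 2) t := fun v μ t => by
    simpa using ((hasDerivAt_id t).const_mul ((1 - μ) / 2)).const_add ((1 + μ) / 2 * v)
  have lin_v : ∀ u μ t : ℝ, HasDerivAt (fun s => (1 + μ) / 2 * s + (1 - μ) / 2 * u)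
      ((1 + μ) / 2) t := fun u μ t => by
    simpa using ((hasDerivAt_id t).const_mul ((1 + μ) / 2)).add_const ((1 - μ) / 2 * u)
  have Q_u : ∀ u v, deriv (fun u' => Q u' v) u = √2 / 4 * ∫ μ in (-1 : ℝ)..1,
      (1 - μ) / 2 * deriv f ((1 + μ) / 2 * v + (1 - μ) / 2 * u) * (√(1 - μ))⁻¹ := by
    intro u v
    simp only [hQ, div_eq_mul_inv _ (√(1 - _))]
    refine ((hasDerivAt_integral_mul_weight
      (G := fun s μ => f ((1 + μ) / 2 * v + (1 - μ) / 2 * s))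
      (G' := fun s μ => (1 - μ) / 2 * deriv f ((1 + μ) / 2 * v + (1 - μ) / 2 * s))
      (by fun_prop) (by fun_prop) (fun t μ => ?_) hW u).const_mul _).deriv
    rw [mul_comm _ (deriv f _)]
    exact (d0 _).comp t (lin_u v μ t)
  have Q_v : deriv (fun v' => Q u v') v = √2 / 4 * ∫ μ in (-1 : ℝ)..1,
      (1 + μ) / 2 * deriv f ((1 + μ) / 2 * v + (1 - μ) / 2 * u) * (√(1 - μ))⁻¹ := by
    simp only [hQ, div_eq_mul_inv _ (√(1 - _))]
    refine ((hasDerivAt_integral_mul_weight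
      (G := fun s μ => f ((1 + μ) / 2 * s + (1 - μ) / 2 * u))
      (G' := fun s μ => (1 + μ) / 2 * deriv f ((1 + μ) / 2 * s + (1 - μ) / 2 * u))
      (by fun_prop) (by fun_prop) (fun t μ => ?_) hW v).const_mul _).deriv
    rw [mul_comm _ (deriv f _)]
    exact (d0 _).comp t (lin_v u μ t)
  have Q_uv : deriv (fun v' => deriv (fun u' => Q u' v') u) v
      = √2 / 4 * ∫ μ in (-1 : ℝ)..1, (1 - μ) / 2 * ((1 + μ) / 2 *
        deriv (deriv f) ((1 + μ) / 2 * v + (1 - μ) / 2 * u)) * (√(1 - μ))⁻¹ := by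
    simp only [Q_u]
    refine ((hasDerivAt_integral_mul_weight
      (G := fun s μ => (1 - μ) / 2 * deriv f ((1 + μ) / 2 * s + (1 - μ) / 2 * u))
      (G' := fun s μ => (1 - μ) / 2 * ((1 + μ) / 2 *
        deriv (deriv f) ((1 + μ) / 2 * s + (1 - μ) / 2 * u)))
      (by fun_prop) (by fun_prop) (fun t μ => ?_) hW v).const_mul _).deriv
    rw [mul_comm ((1 + μ) / 2) (deriv _ _)]
    exact ((d1 _).comp t (lin_v u μ t)).const_mul _
  have parts := integral_one_sub_sq_mul_deriv
    (g := fun μ => deriv f ((1 + μ) / 2 * v + (1 - μ) / 2 * u))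
    (g' := fun μ => deriv (deriv f) ((1 + μ) / 2 * v + (1 - μ) / 2 * u) * ((v - u) / 2))
    (by fun_prop) (by fun_prop) fun μ => by
      refine (d1 _).comp μ (h := fun μ => (1 + μ) / 2 * v + (1 - μ) / 2 * u) ?_
      refine (((((hasDerivAt_id' μ).const_add 1).div_const 2).mul_const v).add
        ((((hasDerivAt_id' μ).const_sub 1).div_const 2).mul_const u)).congr_deriv ?_
      ring
  have left_eq : ∫ μ in (-1 : ℝ)..1, (1 + μ) * (1 - μ) *
        (deriv (deriv f) ((1 + μ) / 2 * v + (1 - μ) / 2 * u) * ((v - u) / 2)) * (√(1 - μ))⁻¹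
      = 2 * (v - u) * ∫ μ in (-1 : ℝ)..1, (1 - μ) / 2 * ((1 + μ) / 2 *
        deriv (deriv f) ((1 + μ) / 2 * v + (1 - μ) / 2 * u)) * (√(1 - μ))⁻¹ := by
    rw [← intervalIntegral.integral_const_mul]
    congr 1 with μ
    ring
  have right_eq : ∫ μ in (-1 : ℝ)..1, ((1 + μ) / 2 - (1 - μ)) *
        deriv f ((1 + μ) / 2 * v + (1 - μ) / 2 * u) * (√(1 - μ))⁻¹
      = (∫ μ in (-1 : ℝ)..1,
          (1 + μ) / 2 * deriv f ((1 + μ) / 2 * v + (1 - μ) / 2 * u) * (√(1 - μ))⁻¹)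
        - 2 * ∫ μ in (-1 : ℝ)..1,
          (1 - μ) / 2 * deriv f ((1 + μ) / 2 * v + (1 - μ) / 2 * u) * (√(1 - μ))⁻¹ := by
    rw [← intervalIntegral.integral_const_mul, ← integral_sub (hW.continuousOn_mul (by fun_prop))
      ((hW.continuousOn_mul (by fun_prop)).const_mul 2)]
    congr 1 with μ
    ring
  rw [left_eq, right_eq] at parts
  rw [Q_uv, Q_u, Q_v, eq_div_iff (mul_ne_zero two_ne_zero (sub_ne_zero.2 huv))]
  linear_combination (-(√2 / 4)) * parts
end

section
/- Let f : ℝ → ℝ be three times continuously differentiable. Define Q(u,v) := (√2/4) ∫_{−1}^{1} f(((1+μ)/2)v + ((1−μ)/2)u)/√(1−μ) dμ. Then for all u, v ∈ ℝ with u ≠ v: ∂³Q/∂u∂v² (u,v) = (4 ∂²Q/∂u∂v (u,v) − ∂²Q/∂v² (u,v)) / (2(u−v)). -/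
open Real intervalIntegral

open MeasureTheory Set in
/-- A continuous function times `1 / √(1 - μ)` is integrable on `[-1, 1]`. -/
theorem intervalIntegrable_div_sqrt_one_sub {g : ℝ → ℝ} (hg : Continuous g) :
    IntervalIntegrable (fun μ => g μ / √(1 - μ)) volume (-1) 1 := by
  have h : IntervalIntegrable (fun x : ℝ => x ^ (-(1 / 2) : ℝ)) volume 0 2 :=
    intervalIntegrable_rpow' (by norm_num)
  have h1 : IntervalIntegrable (fun μ : ℝ => (1 - μ) ^ (-(1 / 2) : ℝ)) volume (-1) 1 := by
    have h2 := (h.comp_sub_left 1).symm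
    norm_num at h2 ⊢
    exact h2
  refine (h1.continuousOn_mul hg.continuousOn).congr fun μ hμ => ?_
  rw [uIoc_of_le (by norm_num)] at hμ
  have h0 : 0 ≤ 1 - μ := by linarith [hμ.2]
  simp only [rpow_neg h0, sqrt_eq_rpow, div_eq_mul_inv]

open MeasureTheory Set in
/-- Differentiation under the integral sign against the weight `1 / √(1 - μ)`. -/
theorem hasDerivAt_integral_div_sqrt_one_sub {F p α β : ℝ → ℝ} (hF : ContDiff ℝ 1 F)
    (hp : Continuous p) (hα : Continuous α) (hβ : Continuous β) (x : ℝ) :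
    HasDerivAt (fun y => ∫ μ in (-1 : ℝ)..1, p μ * F (α μ * y + β μ) / √(1 - μ))
      (∫ μ in (-1 : ℝ)..1, p μ * α μ * deriv F (α μ * x + β μ) / √(1 - μ)) x := by
  have hF0 : Continuous F := hF.continuous
  have hF1 : Continuous (deriv F) := hF.continuous_deriv le_rfl
  obtain ⟨C, hC⟩ := ((isCompact_Icc (a := (-1 : ℝ)) (b := 1)).prod
    (isCompact_closedBall x 1)).exists_bound_of_continuousOn
    (f := fun z : ℝ × ℝ => p z.1 * α z.1 * deriv F (α z.1 * z.2 + β z.1))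
    (Continuous.continuousOn (by fun_prop))
  refine (intervalIntegral.hasDerivAt_integral_of_dominated_loc_of_deriv_le
    (F := fun y μ => p μ * F (α μ * y + β μ) / √(1 - μ))
    (F' := fun y μ => p μ * α μ * deriv F (α μ * y + β μ) / √(1 - μ))
    (bound := fun μ => C / √(1 - μ)) (Metric.closedBall_mem_nhds x one_pos)
    (Filter.Eventually.of_forall fun y => ?_) ?_ ?_ ?_ ?_ ?_).2
  · rw [uIoc_of_le (by norm_num)]
    exact (intervalIntegrable_div_sqrt_one_sub (by fun_prop)).1.aestronglyMeasurable
  · exact intervalIntegrable_div_sqrt_one_sub (by fun_prop)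
  · rw [uIoc_of_le (by norm_num)]
    exact (intervalIntegrable_div_sqrt_one_sub (by fun_prop)).1.aestronglyMeasurable
  · refine Filter.Eventually.of_forall fun μ hμ y hy => ?_
    rw [uIoc_of_le (by norm_num)] at hμ
    rw [norm_div, norm_of_nonneg (sqrt_nonneg _)]
    exact div_le_div_of_nonneg_right (hC (μ, y) ⟨⟨hμ.1.le, hμ.2⟩, hy⟩) (sqrt_nonneg _)
  · exact intervalIntegrable_div_sqrt_one_sub continuous_const
  · refine Filter.Eventually.of_forall fun μ _ y _ => ?_
    have h1 : HasDerivAt (fun y => α μ * y + β μ) (α μ) y := by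
      simpa using ((hasDerivAt_id y).const_mul (α μ)).add_const (β μ)
    have h2 := (hF.differentiable one_ne_zero (α μ * y + β μ)).hasDerivAt.comp y h1
    refine ((h2.const_mul (p μ)).div_const (√(1 - μ))).congr_deriv ?_
    ring

/-- The integral of `p · F` along the segment from `u` to `v`, with the weight `1 / √(1 - μ)`. -/
noncomputable def segmentIntegral (p F : ℝ → ℝ) (u v : ℝ) : ℝ :=
  ∫ μ in (-1 : ℝ)..1, p μ * F ((1 + μ) / 2 * v + (1 - μ) / 2 * u) / √(1 - μ)

theorem hasDerivAt_segmentIntegral_right {F p : ℝ → ℝ} (hF : ContDiff ℝ 1 F)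
    (hp : Continuous p) (u v : ℝ) :
    HasDerivAt (fun v' => segmentIntegral p F u v')
      (segmentIntegral (fun μ => p μ * ((1 + μ) / 2)) (deriv F) u v) v :=
  hasDerivAt_integral_div_sqrt_one_sub hF hp (α := fun μ => (1 + μ) / 2)
    (β := fun μ => (1 - μ) / 2 * u) (by fun_prop) (by fun_prop) v

theorem hasDerivAt_segmentIntegral_left {F p : ℝ → ℝ} (hF : ContDiff ℝ 1 F)
    (hp : Continuous p) (u v : ℝ) :
    HasDerivAt (fun u' => segmentIntegral p F u' v)
      (segmentIntegral (fun μ => p μ * ((1 - μ) / 2)) (deriv F) u v) u := by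
  have h := hasDerivAt_integral_div_sqrt_one_sub hF hp (α := fun μ => (1 - μ) / 2)
    (β := fun μ => (1 + μ) / 2 * v) (by fun_prop) (by fun_prop) u
  simpa only [segmentIntegral, add_comm ((1 + _) / 2 * v)] using h

open MeasureTheory Set in
/-- Integration by parts along the segment, the boundary terms being zero. -/
theorem segmentIntegral_integration_by_parts {F : ℝ → ℝ} (hF : ContDiff ℝ 1 F) (u v : ℝ) :
    2 * (u - v) * segmentIntegral
        (fun μ => 1 * ((1 - μ) / 2) * ((1 + μ) / 2) * ((1 + μ) / 2)) (deriv F) u v =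
      4 * segmentIntegral (fun μ => 1 * ((1 - μ) / 2) * ((1 + μ) / 2)) F u v -
        segmentIntegral (fun μ => 1 * ((1 + μ) / 2) * ((1 + μ) / 2)) F u v := by
  have hF0 : Continuous F := hF.continuous
  have hF1 : Continuous (deriv F) := hF.continuous_deriv le_rfl
  have i1 := (intervalIntegrable_div_sqrt_one_sub (g := fun μ =>
    1 * ((1 - μ) / 2) * ((1 + μ) / 2) * ((1 + μ) / 2) *
      deriv F ((1 + μ) / 2 * v + (1 - μ) / 2 * u)) (by fun_prop)).const_mul (2 * (u - v))
  have i2 := (intervalIntegrable_div_sqrt_one_sub (g := fun μ =>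
    1 * ((1 - μ) / 2) * ((1 + μ) / 2) *
      F ((1 + μ) / 2 * v + (1 - μ) / 2 * u)) (by fun_prop)).const_mul 4
  have i3 := intervalIntegrable_div_sqrt_one_sub (g := fun μ =>
    1 * ((1 + μ) / 2) * ((1 + μ) / 2) *
      F ((1 + μ) / 2 * v + (1 - μ) / 2 * u)) (by fun_prop)
  have key := integral_eq_sub_of_hasDerivAt_of_le (a := (-1 : ℝ)) (b := 1)
    (f := fun μ => 2 * ((1 + μ) / 2) ^ 2 * √(1 - μ) *
      F ((1 + μ) / 2 * v + (1 - μ) / 2 * u)) (by norm_num)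
    (Continuous.continuousOn (by fun_prop)) ?_ ((i2.sub i3).sub i1)
  · rw [integral_sub (i2.sub i3) i1, integral_sub i2 i3] at key
    simp only [intervalIntegral.integral_const_mul] at key
    norm_num at key
    simp only [segmentIntegral]
    norm_num
    linarith
  · intro μ hμ
    have hpos : 0 < 1 - μ := by linarith [hμ.2]
    have hs : √(1 - μ) ≠ 0 := (sqrt_pos.2 hpos).ne'
    have hsq : √(1 - μ) ^ 2 = 1 - μ := sq_sqrt hpos.le
    have ha : HasDerivAt (fun μ : ℝ => (1 + μ) / 2) (1 / 2) μ :=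
      ((hasDerivAt_id μ).const_add 1).div_const 2
    have hl : HasDerivAt (fun μ : ℝ => 1 - μ) (-1) μ := (hasDerivAt_id μ).const_sub 1
    have hseg := (ha.mul_const v).add ((hl.div_const 2).mul_const u)
    have hFc := (hF.differentiable one_ne_zero
      ((1 + μ) / 2 * v + (1 - μ) / 2 * u)).hasDerivAt.comp μ hseg
    have hall := (((ha.pow 2).const_mul 2).mul (hl.sqrt hpos.ne')).mul hFc
    refine hall.congr_deriv ?_
    simp only [Pi.mul_apply, Pi.pow_apply, Function.comp_apply]
    generalize F ((1 + μ) / 2 * v + (1 - μ) / 2 * u) = A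
    generalize deriv F ((1 + μ) / 2 * v + (1 - μ) / 2 * u) = B
    generalize √(1 - μ) = s at hs hsq
    obtain rfl : μ = 1 - s ^ 2 := by linarith
    field_simp
    ring

/-- for `f ∈ C³` and
`Q(u,v) = (√2/4)∫_{−1}^{1} f(((1+μ)/2)v + ((1−μ)/2)u)/√(1−μ) dμ`, one has, for `u ≠ v`,
`∂³Q/∂u∂v² = (4∂²Q/∂u∂v − ∂²Q/∂v²)/(2(u−v))`. -/
theorem Q_third_derivative_identity
    (f : ℝ → ℝ) (hf : ContDiff ℝ 3 f)
    (Q : ℝ → ℝ → ℝ)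
    (hQ : ∀ u v : ℝ, Q u v
      = (Real.sqrt 2 / 4)
          * ∫ μ in (-1:ℝ)..1,
              f ((1 + μ) / 2 * v + (1 - μ) / 2 * u) / Real.sqrt (1 - μ)) :
    ∀ u v : ℝ, u ≠ v →
      deriv (fun v' => deriv (fun v'' => deriv (fun u' => Q u' v'') u) v') v
        = (4 * deriv (fun v' => deriv (fun u' => Q u' v') u) v
            - deriv (fun v' => deriv (fun v'' => Q u v'') v') v)
            / (2 * (u - v)) := by
  intro u v huv
  have hf1 : ContDiff ℝ 2 (deriv f) := ContDiff.deriv' (n := 2) hf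
  have hf2 : ContDiff ℝ 1 (deriv (deriv f)) := ContDiff.deriv' (n := 1) hf1
  have hQ' : ∀ u v, Q u v = √2 / 4 * segmentIntegral (fun _ => 1) f u v := fun u v => by
    simp only [hQ, segmentIntegral, one_mul]
  have hu : ∀ v', deriv (fun u' => Q u' v') u =
      √2 / 4 * segmentIntegral (fun μ => 1 * ((1 - μ) / 2)) (deriv f) u v' := fun v' => by
    simp only [hQ']
    exact ((hasDerivAt_segmentIntegral_left (hf.of_le (by norm_num)) continuous_const
      u v').const_mul _).deriv
  have hv : ∀ v', deriv (fun v'' => Q u v'') v' =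
      √2 / 4 * segmentIntegral (fun μ => 1 * ((1 + μ) / 2)) (deriv f) u v' := fun v' => by
    simp only [hQ']
    exact ((hasDerivAt_segmentIntegral_right (hf.of_le (by norm_num)) continuous_const
      u v').const_mul _).deriv
  have huv' : ∀ v', deriv (fun v'' => deriv (fun u' => Q u' v'') u) v' =
      √2 / 4 * segmentIntegral (fun μ => 1 * ((1 - μ) / 2) * ((1 + μ) / 2))
        (deriv (deriv f)) u v' := fun v' => by
    simp only [hu]
    exact ((hasDerivAt_segmentIntegral_right (hf1.of_le (by norm_num)) (by fun_prop)
      u v').const_mul _).deriv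
  have hvv : deriv (fun v' => deriv (fun v'' => Q u v'') v') v =
      √2 / 4 * segmentIntegral (fun μ => 1 * ((1 + μ) / 2) * ((1 + μ) / 2))
        (deriv (deriv f)) u v := by
    simp only [hv]
    exact ((hasDerivAt_segmentIntegral_right (hf1.of_le (by norm_num)) (by fun_prop)
      u v).const_mul _).deriv
  have huvv : deriv (fun v' => deriv (fun v'' => deriv (fun u' => Q u' v'') u) v') v =
      √2 / 4 * segmentIntegral
        (fun μ => 1 * ((1 - μ) / 2) * ((1 + μ) / 2) * ((1 + μ) / 2))
        (deriv (deriv (deriv f))) u v := by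
    simp only [huv']
    exact ((hasDerivAt_segmentIntegral_right hf2 (by fun_prop) u v).const_mul _).deriv
  rw [huvv, huv', hvv, eq_div_iff (mul_ne_zero two_ne_zero (sub_ne_zero.2 huv))]
  linear_combination √2 / 4 * segmentIntegral_integration_by_parts hf2 u v
end
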